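/- Fix a Hermitian γ_{AR} on A ⊗ R and positive semidefinite σ_A on A. Then sup over positive semidefinite σ_{AR} with tr_R σ_{AR} = σ_A of tr[σ_{AR} γ_{AR}] equals inf over Hermitian Λ_A with Λ_A ⊗ I_R ≥ γ_{AR} of tr[σ_A Λ_A]. -/

import Mathlib

open Matrix
open scoped ComplexOrder Kronecker

noncomputable section

/-- Partial trace over the second tensor factor. -/
def ptraceR {ιA ιR : Type*} [Fintype ιR]
    (M : Matrix (ιA × ιR) (ιA × ιR) ℂ) : Matrix ιA ιA ℂ :=
  fun i j => ∑ k : ιR, M (i, k) (j, k)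

namespace Matrix

/-- Over `ℂ`, a positive semidefinite matrix has the form `Bᴴ * B`. -/
lemma PosSemidef.exists_eq_conjTranspose_mul_self {n : Type*} [Fintype n]
    {X : Matrix n n ℂ} (hX : X.PosSemidef) : ∃ B : Matrix n n ℂ, X = Bᴴ * B := by
  classical
  open scoped MatrixOrder Matrix.Norms.L2Operator in
  exact CStarAlgebra.nonneg_iff_eq_star_mul_self.mp hX.nonneg

lemma PosSemidef.re_trace_mul_nonneg {n : Type*} [Fintype n] {X Y : Matrix n n ℂ}
    (hX : X.PosSemidef) (hY : Y.PosSemidef) : 0 ≤ (X * Y).trace.re := by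
  obtain ⟨B, rfl⟩ := hX.exists_eq_conjTranspose_mul_self
  rw [mul_assoc, trace_mul_comm]
  exact (Complex.nonneg_iff.mp (hY.mul_mul_conjTranspose_same B).trace_nonneg).1

/-- Self-duality of the positive semidefinite cone. -/
lemma IsHermitian.posSemidef_of_re_trace_mul_nonneg {n : Type*} [Fintype n]
    {Y : Matrix n n ℂ} (hY : Y.IsHermitian)
    (h : ∀ X : Matrix n n ℂ, X.PosSemidef → 0 ≤ (X * Y).trace.re) : Y.PosSemidef := by
  refine .of_dotProduct_mulVec_nonneg hY fun v => ?_
  have hv := h _ (posSemidef_vecMulVec_self_star v)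
  rw [vecMulVec_mul, trace_vecMulVec, dotProduct_comm, ← dotProduct_mulVec] at hv
  exact Complex.nonneg_iff.mpr ⟨hv, (hY.im_star_dotProduct_mulVec_self v).symm⟩

lemma norm_apply_sq_le_re_trace {m n : Type*} [Fintype m] [Fintype n] (B : Matrix m n ℂ)
    (i : m) (j : n) : ‖B i j‖ ^ 2 ≤ (Bᴴ * B).trace.re := by
  have h : (Bᴴ * B).trace.re = ∑ j, ∑ i, ‖B i j‖ ^ 2 := by
    simp [trace, mul_apply, ← Complex.normSq_eq_norm_sq, Complex.normSq_apply]
  rw [h]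
  calc ‖B i j‖ ^ 2 ≤ ∑ i, ‖B i j‖ ^ 2 :=
        Finset.single_le_sum (f := fun i => ‖B i j‖ ^ 2) (fun _ _ => by positivity)
          (Finset.mem_univ i)
    _ ≤ _ := Finset.single_le_sum (f := fun j => ∑ i, ‖B i j‖ ^ 2)
          (fun _ _ => by positivity) (Finset.mem_univ j)

/-- Every real-linear functional restricts to Hermitian matrices as the trace pairing with a
Hermitian matrix. -/
lemma exists_isHermitian_eq_re_trace_mul {n : Type*} [Fintype n]
    (g : Matrix n n ℂ →ₗ[ℝ] ℝ) :
    ∃ L : Matrix n n ℂ, L.IsHermitian ∧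
      ∀ M : Matrix n n ℂ, M.IsHermitian → g M = (M * L).trace.re := by
  classical
  let F : Module.Dual ℂ (Matrix n n ℂ) := Module.Dual.extendRCLike g
  let N : Matrix n n ℂ := of fun j i => F (single i j 1)
  have hF (M : Matrix n n ℂ) : F M = (M * N).trace := by
    conv_lhs => rw [matrix_eq_sum_single M]
    simp only [map_sum, trace, diag_apply, mul_apply]
    refine Finset.sum_congr rfl fun i _ => Finset.sum_congr rfl fun j _ => ?_
    rw [show single i j (M i j) = M i j • single i j (1 : ℂ) by simp, map_smul]
    rfl
  have hg (M : Matrix n n ℂ) : g M = (M * N).trace.re := by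
    rw [← hF]
    exact (Module.Dual.re_extendRCLike_apply (𝕜 := ℂ) g M).symm
  refine ⟨(2⁻¹ : ℝ) • (N + Nᴴ), ?_, fun M hM => ?_⟩
  · simp [IsHermitian, add_comm]
  · have hstar : (M * Nᴴ).trace.re = (M * N).trace.re := by
      rw [trace_mul_comm]
      nth_rw 1 [← hM.eq]
      rw [← conjTranspose_mul, trace_conjTranspose]
      simp
    rw [hg, mul_smul_comm, trace_smul, mul_add, trace_add, Complex.smul_re, Complex.add_re,
      hstar, smul_eq_mul]
    ring

end Matrix

section PartialTrace

variable {ιA ιR : Type*} [Fintype ιR]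

lemma ptraceR_add (X Y : Matrix (ιA × ιR) (ιA × ιR) ℂ) :
    ptraceR (X + Y) = ptraceR X + ptraceR Y := by
  ext i j
  simp [ptraceR, Finset.sum_add_distrib]

lemma ptraceR_smul (r : ℝ) (X : Matrix (ιA × ιR) (ιA × ιR) ℂ) :
    ptraceR (r • X) = r • ptraceR X := by
  ext i j
  simp [ptraceR, Finset.mul_sum]

lemma Matrix.IsHermitian.ptraceR {X : Matrix (ιA × ιR) (ιA × ιR) ℂ} (hX : X.IsHermitian) :
    (ptraceR X).IsHermitian := by
  ext i j
  simp only [conjTranspose_apply, _root_.ptraceR, star_sum]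
  exact Finset.sum_congr rfl fun k _ => hX.apply _ _

lemma continuous_ptraceR :
    Continuous (ptraceR : Matrix (ιA × ιR) (ιA × ιR) ℂ → Matrix ιA ιA ℂ) := by
  refine continuous_matrix fun i j => ?_
  exact continuous_finsetSum _ fun k _ => continuous_id.matrix_elem _ _

lemma ptraceR_kronecker (S : Matrix ιA ιA ℂ) (T : Matrix ιR ιR ℂ) :
    ptraceR (S ⊗ₖ T) = T.trace • S := by
  ext i j
  simp [ptraceR, trace, ← Finset.mul_sum, mul_comm]

variable [Fintype ιA]

lemma trace_ptraceR (X : Matrix (ιA × ιR) (ιA × ιR) ℂ) : (ptraceR X).trace = X.trace := by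
  simp [trace, ptraceR, Fintype.sum_prod_type]

/-- The partial trace is adjoint to tensoring with the identity. -/
lemma trace_mul_kronecker_one [DecidableEq ιR] (X : Matrix (ιA × ιR) (ιA × ιR) ℂ)
    (L : Matrix ιA ιA ℂ) :
    (X * (L ⊗ₖ (1 : Matrix ιR ιR ℂ))).trace = (ptraceR X * L).trace := by
  simp only [trace, diag_apply, mul_apply, ptraceR, kroneckerMap_apply, Fintype.sum_prod_type,
    one_apply, mul_ite, mul_one, mul_zero, Finset.sum_ite_eq', Finset.mem_univ, if_true,
    Finset.sum_mul]
  exact Finset.sum_congr rfl fun i _ => Finset.sum_comm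

section StrongDuality

open Filter Topology

attribute [local instance] Matrix.normedAddCommGroup Matrix.normedSpace

local instance : FirstCountableTopology (Matrix ιA ιA ℂ) :=
  inferInstanceAs (FirstCountableTopology (ιA → ιA → ℂ))

local instance : LocallyConvexSpace ℝ (Matrix ιA ιA ℂ) :=
  inferInstanceAs (LocallyConvexSpace ℝ (ιA → ιA → ℂ))

/-- The closed convex cone of pairs `(tr_R X, tr[X γ])` with `X` positive semidefinite. -/
def ptraceCone (γ : Matrix (ιA × ιR) (ιA × ιR) ℂ) : ProperCone ℝ (Matrix ιA ιA ℂ × ℝ) where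
  carrier := {p | ∃ X : Matrix (ιA × ιR) (ιA × ιR) ℂ,
    X.PosSemidef ∧ ptraceR X = p.1 ∧ (X * γ).trace.re = p.2}
  zero_mem' := ⟨0, .zero, by ext; simp [ptraceR], by simp⟩
  add_mem' := by
    rintro _ _ ⟨X, hX, hX₁, hX₂⟩ ⟨Y, hY, hY₁, hY₂⟩
    exact ⟨X + Y, hX.add hY, by rw [ptraceR_add, hX₁, hY₁]; rfl,
      by rw [add_mul, trace_add, Complex.add_re, hX₂, hY₂]; rfl⟩
  smul_mem' := by
    rintro ⟨r, hr⟩ _ ⟨X, hX, hX₁, hX₂⟩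
    exact ⟨r • X, hX.smul hr, by rw [ptraceR_smul, hX₁]; rfl,
      by rw [smul_mul_assoc, trace_smul, Complex.smul_re, hX₂]; rfl⟩
  isClosed' := by
    refine IsSeqClosed.isClosed fun p q hp hpq => ?_
    have hB (n : ℕ) : ∃ B : Matrix (ιA × ιR) (ιA × ιR) ℂ,
        ptraceR (Bᴴ * B) = (p n).1 ∧ (Bᴴ * B * γ).trace.re = (p n).2 := by
      obtain ⟨X, hX, h⟩ := hp n
      obtain ⟨B, rfl⟩ := hX.exists_eq_conjTranspose_mul_self
      exact ⟨B, h⟩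
    choose B hB₁ hB₂ using hB
    have hp₁ : Tendsto (fun n => (p n).1) atTop (𝓝 q.1) := (continuous_fst.tendsto q).comp hpq
    have hp₂ : Tendsto (fun n => (p n).2) atTop (𝓝 q.2) := (continuous_snd.tendsto q).comp hpq
    have htr : Tendsto (fun n => (p n).1.trace.re) atTop (𝓝 q.1.trace.re) :=
      ((Complex.continuous_re.comp continuous_id.matrix_trace).tendsto q.1).comp hp₁
    obtain ⟨C, hC⟩ := htr.bddAbove_range
    have hbound (n : ℕ) : B n ∈ Metric.closedBall 0 √C := by
      rw [mem_closedBall_zero_iff, Matrix.norm_le_iff (Real.sqrt_nonneg C)]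
      intro i j
      refine Real.le_sqrt_of_sq_le ((norm_apply_sq_le_re_trace (B n) i j).trans ?_)
      rw [← trace_ptraceR, hB₁]
      exact hC ⟨n, rfl⟩
    obtain ⟨B₀, -, φ, hφ, hlim⟩ := tendsto_subseq_of_bounded Metric.isBounded_closedBall hbound
    have hsq : Continuous fun M : Matrix (ιA × ιR) (ιA × ιR) ℂ => Mᴴ * M :=
      continuous_id.matrix_conjTranspose.matrix_mul continuous_id
    refine ⟨B₀ᴴ * B₀, posSemidef_conjTranspose_mul_self B₀, ?_, ?_⟩
    · refine tendsto_nhds_unique (((continuous_ptraceR.comp hsq).tendsto B₀).comp hlim) ?_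
      refine (hp₁.comp hφ.tendsto_atTop).congr fun n => (hB₁ (φ n)).symm
    · have hcont : Continuous fun M : Matrix (ιA × ιR) (ιA × ιR) ℂ => (Mᴴ * M * γ).trace.re :=
        Complex.continuous_re.comp (hsq.matrix_mul continuous_const).matrix_trace
      refine tendsto_nhds_unique ((hcont.tendsto B₀).comp hlim) ?_
      refine (hp₂.comp hφ.tendsto_atTop).congr fun n => (hB₂ (φ n)).symm

/-- Strong duality: if the primal problem is feasible and all of its values are below `c`, then
some dual feasible point has value below `c`. -/
lemma exists_dual_feasible_lt [DecidableEq ιR] {γ : Matrix (ιA × ιR) (ιA × ιR) ℂ}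
    (hγ : γ.IsHermitian) {S : Matrix ιA ιA ℂ}
    {X₀ : Matrix (ιA × ιR) (ιA × ιR) ℂ} (hX₀ : X₀.PosSemidef) (hX₀S : ptraceR X₀ = S) {c : ℝ}
    (hc : ∀ X : Matrix (ιA × ιR) (ιA × ιR) ℂ, X.PosSemidef → ptraceR X = S →
      (X * γ).trace.re < c) :
    ∃ L : Matrix ιA ιA ℂ, L.IsHermitian ∧
      (L ⊗ₖ (1 : Matrix ιR ιR ℂ) - γ).PosSemidef ∧ (S * L).trace.re < c := by
  have hnot : (S, c) ∉ ptraceCone γ := by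
    rintro ⟨X, hX, hXS, hXc⟩
    exact (hc X hX hXS).ne hXc
  obtain ⟨f, hf, hfS⟩ := (ptraceCone γ).hyperplane_separation_point hnot
  obtain ⟨N, hN, hfN⟩ := exists_isHermitian_eq_re_trace_mul
    (f.toLinearMap ∘ₗ LinearMap.inl ℝ (Matrix ιA ιA ℂ) ℝ)
  have hS : S.IsHermitian := hX₀S ▸ hX₀.isHermitian.ptraceR
  set s := f (0, 1) with hs
  have hf_eq (M : Matrix ιA ιA ℂ) (hM : M.IsHermitian) (t : ℝ) :
      f (M, t) = (M * N).trace.re + t * s := by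
    rw [← hfN M hM, hs, ← smul_eq_mul, ← map_smul]
    simp [← map_add]
  have hcone (X : Matrix (ιA × ιR) (ιA × ιR) ℂ) (hX : X.PosSemidef) :
      0 ≤ (ptraceR X * N).trace.re + (X * γ).trace.re * s := by
    rw [← hf_eq _ hX.isHermitian.ptraceR]
    exact hf _ ⟨X, hX, rfl, rfl⟩
  rw [hf_eq S hS] at hfS
  have hs_neg : s < 0 := by
    have h₀ := hcone X₀ hX₀
    rw [hX₀S] at h₀
    nlinarith [hc X₀ hX₀ hX₀S]
  have hL : ((-s)⁻¹ • N).IsHermitian := by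
    rw [IsHermitian, conjTranspose_smul, hN.eq, star_trivial]
  refine ⟨(-s)⁻¹ • N, hL, IsHermitian.posSemidef_of_re_trace_mul_nonneg ?_ fun X hX => ?_, ?_⟩
  · refine IsHermitian.sub ?_ hγ
    rw [IsHermitian, conjTranspose_kronecker, hL.eq, conjTranspose_one]
  · rw [mul_sub, trace_sub, trace_mul_kronecker_one, mul_smul_comm, trace_smul, Complex.sub_re,
      Complex.smul_re, smul_eq_mul, sub_nonneg, inv_mul_eq_div, le_div_iff₀ (by linarith)]
    linarith [hcone X hX]
  · rw [mul_smul_comm, trace_smul, Complex.smul_re, smul_eq_mul, inv_mul_eq_div,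
      div_lt_iff₀ (by linarith)]
    linarith

end StrongDuality

/-- Weak duality. -/
lemma re_trace_mul_le_of_feasible [DecidableEq ιR] {γ X : Matrix (ιA × ιR) (ιA × ιR) ℂ}
    {L : Matrix ιA ιA ℂ} (hX : X.PosSemidef)
    (hL : (L ⊗ₖ (1 : Matrix ιR ιR ℂ) - γ).PosSemidef) :
    (X * γ).trace.re ≤ (ptraceR X * L).trace.re := by
  have h := hX.re_trace_mul_nonneg hL
  rwa [mul_sub, trace_sub, trace_mul_kronecker_one, Complex.sub_re, sub_nonneg] at h

/-- A positive semidefinite matrix on `A` extends to `A ⊗ R` when `R` is nontrivial. -/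
lemma exists_posSemidef_ptraceR_eq [Nonempty ιR] {S : Matrix ιA ιA ℂ} (hS : S.PosSemidef) :
    ∃ X : Matrix (ιA × ιR) (ιA × ιR) ℂ, X.PosSemidef ∧ ptraceR X = S := by
  classical
  obtain ⟨k⟩ := ‹Nonempty ιR›
  refine ⟨S ⊗ₖ diagonal (Pi.single k 1), hS.kronecker (.diagonal ?_), ?_⟩
  · exact Pi.single_nonneg.mpr zero_le_one
  · simp [ptraceR_kronecker]

end PartialTrace

/-- SDP duality: for Hermitian `γ_{AR}` and positive semidefinite `σ_A`,
`sup { tr[σ_{AR} γ_{AR}] : σ_{AR} ≽ 0, tr_R σ_{AR} = σ_A }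
  = inf { tr[σ_A Λ_A] : Λ_A Hermitian, Λ_A ⊗ I_R ≥ γ_{AR} }`. -/
theorem sdp_duality_sup {ιA ιR : Type*} [Fintype ιA] [DecidableEq ιA]
    [Fintype ιR] [DecidableEq ιR]
    (γ : Matrix (ιA × ιR) (ιA × ιR) ℂ) (hγ : γ.IsHermitian)
    (σA : Matrix ιA ιA ℂ) (hσA : σA.PosSemidef) :
    (⨆ (σAR : Matrix (ιA × ιR) (ιA × ιR) ℂ)
        (_ : σAR.PosSemidef ∧ ptraceR σAR = σA),
        (((σAR * γ).trace.re : ℝ) : EReal)) =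
    (⨅ (Λ : Matrix ιA ιA ℂ)
        (_ : Λ.IsHermitian ∧ (Λ ⊗ₖ (1 : Matrix ιR ιR ℂ) - γ).PosSemidef),
        (((σA * Λ).trace.re : ℝ) : EReal)) := by
  apply le_antisymm
  · refine iSup₂_le fun X hX => le_iInf₂ fun L hL => ?_
    rw [← hX.2]
    exact_mod_cast re_trace_mul_le_of_feasible hX.1 hL.2
  · refine EReal.le_of_forall_lt_iff_le.mp fun c hc => ?_
    have hlt (X : Matrix (ιA × ιR) (ιA × ιR) ℂ) (hX : X.PosSemidef) (hXS : ptraceR X = σA) :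
        (X * γ).trace.re < c := by
      exact_mod_cast (le_iSup₂ (f := fun (X : Matrix (ιA × ιR) (ιA × ιR) ℂ)
        (_ : X.PosSemidef ∧ ptraceR X = σA) => (((X * γ).trace.re : ℝ) : EReal))
        X ⟨hX, hXS⟩).trans_lt hc
    suffices h : ∃ L : Matrix ιA ιA ℂ, L.IsHermitian ∧
        (L ⊗ₖ (1 : Matrix ιR ιR ℂ) - γ).PosSemidef ∧ (σA * L).trace.re ≤ c by
      obtain ⟨L, hL, hLγ, hLc⟩ := h
      exact iInf₂_le_of_le L ⟨hL, hLγ⟩ (by exact_mod_cast hLc)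
    by_cases hfeas : ∃ X : Matrix (ιA × ιR) (ιA × ιR) ℂ, X.PosSemidef ∧ ptraceR X = σA
    · obtain ⟨X₀, hX₀, hX₀S⟩ := hfeas
      obtain ⟨L, hL, hLγ, hLc⟩ := exists_dual_feasible_lt hγ hX₀ hX₀S hlt
      exact ⟨L, hL, hLγ, hLc.le⟩
    · have hR : IsEmpty ιR := not_nonempty_iff.mp fun _ =>
        hfeas (exists_posSemidef_ptraceR_eq hσA)
      have htr : σA.trace.re ≠ 0 := fun h0 => by
        have hzero : σA = 0 := hσA.trace_eq_zero_iff.mp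
          (Complex.ext h0 (Complex.nonneg_iff.mp hσA.trace_nonneg).2.symm)
        exact hfeas ⟨0, .zero, by ext; simp [ptraceR, hzero]⟩
      refine ⟨(c / σA.trace.re) • 1, ?_, ?_, ?_⟩
      · simp [IsHermitian]
      · rw [Subsingleton.elim (_ - γ) 0]
        exact .zero
      · rw [mul_smul_comm, mul_one, trace_smul, Complex.smul_re, smul_eq_mul,
          div_mul_cancel₀ _ htr]

end
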